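/- arXiv:2104.14138 — 2 statements merged into one kernel-verified Lean document; each statement's English description precedes it below -/
import Mathlib

section
/- Let (Ω, μ) be a probability space, b > 1, N ∈ ℕ, γ ∈ [0, 1), and let (R_k)_{k∈ℕ} be a sequence of measurable real-valued random variables on Ω with |R_k(ω)| ≤ (b^{N+1} − 1)/(b − 1) for all k and ω. Then the expected discounted return equals the weighted sum of expected discounted spectral returns: E[∑_{k=0}^{∞} γ^k · R_k] = ∑_{i=0}^{N} b^i · E[∑_{k=0}^{∞} γ^k · (R_k)_b^i], where all series converge absolutely and all expectations are finite. -/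
open MeasureTheory

/-- Clamp a real number to the interval [0, 1]. -/
noncomputable def clamp (x : ℝ) : ℝ := max 0 (min x 1)

/-- The `i`-th spectral component of the real number `r` to base `b`. -/
noncomputable def spec (b r : ℝ) (i : ℕ) : ℝ :=
  Real.sign r * clamp ((|r| - (b ^ i - 1) / (b - 1)) / b ^ i)

theorem sum_clamp (b x : ℝ) (hb : 1 < b) (hx : 0 ≤ x) (n : ℕ) :
    ∑ i ∈ Finset.range n, b ^ i * clamp ((x - (b ^ i - 1) / (b - 1)) / b ^ i)
      = min x ((b ^ n - 1) / (b - 1)) := by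
  induction n with
  | zero => simp [hx]
  | succ n ih =>
    rw [Finset.sum_range_succ, ih]
    have hp : 0 < b ^ n := by positivity
    have hb1 : b - 1 ≠ 0 := by linarith
    have hS : (b ^ (n + 1) - 1) / (b - 1) = (b ^ n - 1) / (b - 1) + b ^ n := by
      field_simp
      ring
    rw [hS]
    generalize (b ^ n - 1) / (b - 1) = S
    have : b ^ n * clamp ((x - S) / b ^ n) = max 0 (min (x - S) (b ^ n)) := by
      unfold clamp
      rw [mul_max_of_nonneg _ _ hp.le, mul_min_of_nonneg _ _ hp.le, mul_zero, mul_one,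
        mul_div_cancel₀ _ hp.ne']
    rw [this]
    grind

theorem sum_spec (b r : ℝ) (hb : 1 < b) (N : ℕ) (hr : |r| ≤ (b ^ (N + 1) - 1) / (b - 1)) :
    r = ∑ i ∈ Finset.range (N + 1), b ^ i * spec b r i := by
  have h := sum_clamp b |r| hb (abs_nonneg r) (N + 1)
  rw [min_eq_left hr] at h
  have h2 : Real.sign r * |r| = r := by
    rcases lt_trichotomy r 0 with h | h | h
    · rw [Real.sign_of_neg h, abs_of_neg h]; ring
    · simp [h]
    · rw [Real.sign_of_pos h, abs_of_pos h]; ring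
  conv_lhs => rw [← h2, ← h, Finset.mul_sum]
  refine Finset.sum_congr rfl fun i _ => ?_
  unfold spec
  ring

theorem abs_spec_le (b r : ℝ) (i : ℕ) : |spec b r i| ≤ 1 := by
  unfold spec clamp
  rw [abs_mul]
  refine mul_le_one₀ ?_ (abs_nonneg _) ?_
  · rcases Real.sign_apply_eq r with h | h | h <;> simp [h]
  · rw [abs_of_nonneg (le_max_left _ _)]
    simp

theorem measurable_spec (b : ℝ) (i : ℕ) : Measurable (fun r => spec b r i) := by
  have hs : Measurable Real.sign := by
    unfold Real.sign
    exact Measurable.ite measurableSet_Iio measurable_const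
      (Measurable.ite measurableSet_Ioi measurable_const measurable_const)
  unfold spec clamp
  refine hs.mul ?_
  have h : Continuous fun r : ℝ => max 0 (min ((|r| - (b ^ i - 1) / (b - 1)) / b ^ i) 1) := by
    fun_prop
  exact h.measurable

theorem disc_summable (γ : ℝ) (hγ0 : 0 ≤ γ) (hγ1 : γ < 1) (f : ℕ → ℝ) (C : ℝ)
    (hC : ∀ k, |f k| ≤ C) : Summable (fun k : ℕ => |γ ^ k * f k|) := by
  refine Summable.of_nonneg_of_le (fun _ => abs_nonneg _) (fun k => ?_)
    ((summable_geometric_of_lt_one hγ0 hγ1).mul_right C)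
  rw [abs_mul, abs_of_nonneg (pow_nonneg hγ0 k)]
  exact mul_le_mul_of_nonneg_left (hC k) (pow_nonneg hγ0 k)

theorem disc_integrable {Ω : Type*} [MeasurableSpace Ω] (μ : Measure Ω) [IsProbabilityMeasure μ]
    (γ : ℝ) (hγ0 : 0 ≤ γ) (hγ1 : γ < 1) (f : ℕ → Ω → ℝ) (hf : ∀ k, Measurable (f k)) (C : ℝ)
    (hC : ∀ k ω, |f k ω| ≤ C) : Integrable (fun ω => ∑' k : ℕ, γ ^ k * f k ω) μ := by
  have hsum := fun ω => (disc_summable γ hγ0 hγ1 (fun k => f k ω) C (fun k => hC k ω)).of_abs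
  have hm : Measurable (fun ω => ∑' k : ℕ, γ ^ k * f k ω) := by
    refine measurable_of_tendsto_metrizable
      (f := fun n ω => ∑ k ∈ Finset.range n, γ ^ k * f k ω) (fun n => ?_) ?_
    · exact Finset.measurable_sum _ fun k _ => (hf k).const_mul _
    · rw [tendsto_pi_nhds]
      exact fun ω => (hsum ω).hasSum.tendsto_sum_nat
  refine Integrable.of_bound hm.aestronglyMeasurable (∑' k : ℕ, γ ^ k * C)
    (Filter.Eventually.of_forall fun ω => ?_)
  refine tsum_of_norm_bounded ((summable_geometric_of_lt_one hγ0 hγ1).mul_right C).hasSum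
    fun k => ?_
  rw [Real.norm_eq_abs, abs_mul, abs_of_nonneg (pow_nonneg hγ0 k)]
  exact mul_le_mul_of_nonneg_left (hC k ω) (pow_nonneg hγ0 k)

/-- On a probability space, for a uniformly bounded sequence of measurable random rewards,
the expected discounted return equals the weighted sum of expected discounted spectral
returns; all series converge absolutely and all expectations are finite. -/
theorem expected_return_decomposition
    {Ω : Type*} [MeasurableSpace Ω] (μ : Measure Ω) [IsProbabilityMeasure μ]
    (b : ℝ) (hb : 1 < b) (N : ℕ) (γ : ℝ) (hγ0 : 0 ≤ γ) (hγ1 : γ < 1)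
    (R : ℕ → Ω → ℝ) (hmeas : ∀ k, Measurable (R k))
    (hbound : ∀ k ω, |R k ω| ≤ (b ^ (N + 1) - 1) / (b - 1)) :
    (∀ ω, Summable (fun k : ℕ => |γ ^ k * R k ω|)) ∧
    (∀ ω, ∀ i : ℕ, Summable (fun k : ℕ => |γ ^ k * spec b (R k ω) i|)) ∧
    Integrable (fun ω => ∑' k : ℕ, γ ^ k * R k ω) μ ∧
    (∀ i : ℕ, Integrable (fun ω => ∑' k : ℕ, γ ^ k * spec b (R k ω) i) μ) ∧
    ∫ ω, (∑' k : ℕ, γ ^ k * R k ω) ∂μ =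
      ∑ i ∈ Finset.range (N + 1),
        b ^ i * ∫ ω, (∑' k : ℕ, γ ^ k * spec b (R k ω) i) ∂μ := by
  have hI : ∀ i : ℕ, Integrable (fun ω => ∑' k : ℕ, γ ^ k * spec b (R k ω) i) μ := fun i =>
    disc_integrable μ γ hγ0 hγ1 (fun k ω => spec b (R k ω) i)
      (fun k => (measurable_spec b i).comp (hmeas k)) 1 (fun k ω => abs_spec_le _ _ _)
  have hS : ∀ ω, ∀ i : ℕ, Summable (fun k : ℕ => |γ ^ k * spec b (R k ω) i|) := fun ω i =>
    disc_summable γ hγ0 hγ1 _ 1 (fun k => abs_spec_le _ _ _)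
  refine ⟨fun ω => disc_summable γ hγ0 hγ1 _ _ (fun k => hbound k ω), hS,
    disc_integrable μ γ hγ0 hγ1 R hmeas _ hbound, hI, ?_⟩
  simp_rw [← integral_const_mul]
  rw [← integral_finsetSum _ (fun i _ => (hI i).const_mul _)]
  congr 1
  funext ω
  simp_rw [← tsum_mul_left]
  rw [← Summable.tsum_finsetSum (fun i _ => (hS ω i).of_abs.mul_left _)]
  refine tsum_congr fun k => ?_
  conv_lhs => rw [sum_spec b (R k ω) hb N (hbound k ω), Finset.mul_sum]
  exact Finset.sum_congr rfl fun i _ => by ring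
end

section
/- Let b > 1, N ∈ ℕ, α, γ ∈ ℝ, and let r be a real number with |r| ≤ (b^{N+1} − 1)/(b − 1). Let Q_0, …, Q_N and Q'_0, …, Q'_N be real numbers, and set Q = ∑_{i=0}^{N} b^i Q_i and Q' = ∑_{i=0}^{N} b^i Q'_i. Then performing the per-frequency Q-learning update on each component and re-summing agrees with the standard Q-learning update on the aggregates: ∑_{i=0}^{N} b^i · (Q_i + α(r_b^i + γ Q'_i − Q_i)) = Q + α(r + γ Q' − Q). -/
/-- Partial sums of the clamped magnitudes truncate `x` at the geometric sum. -/
theorem sum_clamp_eq_min (b : ℝ) (hb : 1 < b) (x : ℝ) (hx : 0 ≤ x) (n : ℕ) :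
    ∑ i ∈ Finset.range n, b ^ i * clamp ((x - (b ^ i - 1) / (b - 1)) / b ^ i) =
      min x ((b ^ n - 1) / (b - 1)) := by
  induction n with
  | zero => simp [hx]
  | succ n ih =>
    rw [Finset.sum_range_succ, ih]
    have hp : 0 < b ^ n := by positivity
    have hb1 : b - 1 ≠ 0 := by linarith
    have hS : (b ^ (n + 1) - 1) / (b - 1) = (b ^ n - 1) / (b - 1) + b ^ n := by
      field_simp
      ring
    rw [hS]
    generalize (b ^ n - 1) / (b - 1) = s
    have hc : b ^ n * clamp ((x - s) / b ^ n) = max 0 (min (x - s) (b ^ n)) := by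
      unfold clamp
      rw [mul_max_of_nonneg _ _ hp.le, mul_min_of_nonneg _ _ hp.le, mul_zero, mul_one,
        mul_div_cancel₀ _ hp.ne']
    rw [hc]
    grind

/-- The spectral components re-sum to `r`. -/
theorem sum_spec_eq (b : ℝ) (hb : 1 < b) (N : ℕ) (r : ℝ)
    (hr : |r| ≤ (b ^ (N + 1) - 1) / (b - 1)) :
    ∑ i ∈ Finset.range (N + 1), b ^ i * spec b r i = r := by
  have h := sum_clamp_eq_min b hb |r| (abs_nonneg r) (N + 1)
  rw [min_eq_left hr] at h
  have h2 : ∑ i ∈ Finset.range (N + 1), b ^ i * spec b r i = Real.sign r * |r| := by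
    conv_rhs => rw [← h, Finset.mul_sum]
    refine Finset.sum_congr rfl fun i _ => ?_
    unfold spec
    ring
  rw [h2]
  rcases lt_trichotomy r 0 with h0 | h0 | h0
  · rw [Real.sign_of_neg h0, abs_of_neg h0]; ring
  · simp [h0]
  · rw [Real.sign_of_pos h0, abs_of_pos h0]; ring

/-- Performing the per-frequency Q-learning update on each spectral component and re-summing
agrees with the standard Q-learning update on the aggregates. -/
theorem spectral_update_aggregates (b : ℝ) (hb : 1 < b) (N : ℕ) (α γ : ℝ) (r : ℝ)
    (hr : |r| ≤ (b ^ (N + 1) - 1) / (b - 1))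
    (Qc Qc' : ℕ → ℝ)
    (Q Q' : ℝ)
    (hQ : Q = ∑ i ∈ Finset.range (N + 1), b ^ i * Qc i)
    (hQ' : Q' = ∑ i ∈ Finset.range (N + 1), b ^ i * Qc' i) :
    ∑ i ∈ Finset.range (N + 1),
        b ^ i * (Qc i + α * (spec b r i + γ * Qc' i - Qc i)) =
      Q + α * (r + γ * Q' - Q) := by
  have hs := sum_spec_eq b hb N r hr
  calc _ = ∑ i ∈ Finset.range (N + 1), (b ^ i * Qc i + α * (b ^ i * spec b r i
        + γ * (b ^ i * Qc' i) - b ^ i * Qc i)) :=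
        Finset.sum_congr rfl fun i _ => by ring
    _ = _ := by
      rw [Finset.sum_add_distrib, ← Finset.mul_sum, Finset.sum_sub_distrib,
        Finset.sum_add_distrib, ← Finset.mul_sum, hs, ← hQ, ← hQ']
end
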